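/- Let G : 𝒳 → Δ × S be a proper semistable holomorphic fibration with connected fibers, where 𝒳 is a smooth (n+1)-dimensional Kähler manifold, S a smooth compact projective curve and Δ ⊂ ℂ a disk, such that the fibers of f := p_Δ ∘ G are smooth. Choose local coordinates t on Δ and s on S. Then there exist a change of coordinates t' = t, s' = s − l(t) on Δ × S (for some holomorphic function l) and local coordinates x_1, …, x_{n+1} on 𝒳 such that G is locally given by t' = x_{n+1}, s' = x_1 ⋯ x_p with p ≤ n. -/

import Mathlib

/-!
# Statement 0 (local coordinates for a semistable fibration over `Δ × S`)

Let `G : 𝒳 → Δ × S` be a proper semistable holomorphic fibration with connected fibers,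
where `𝒳` is a smooth `(n+1)`-dimensional Kähler manifold, `S` a smooth compact projective
curve and `Δ ⊂ ℂ` a disk, such that the fibers of `f := p_Δ ∘ G` are smooth.  Choose local
coordinates `t` on `Δ` and `s` on `S`.  Then there exist a change of coordinates `t' = t`,
`s' = s − l(t)` on `Δ × S` (for some holomorphic function `l`) and local coordinates
`x_1, …, x_{n+1}` on `𝒳` such that `G` is locally given by `t' = x_{n+1}`,
`s' = x_1 ⋯ x_p` with `p ≤ n`.

Since the statement is local, we fix an initial holomorphic chart of `𝒳` around the point
of interest `x₀` (identifying a neighbourhood with a neighbourhood in `ℂ^{n+1}`), and the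
chosen coordinates `(t, s)` on `Δ × S` (identifying it locally with `ℂ × ℂ`, centered so
that `G x₀ = (0,0)`).  "Local coordinates" are modeled by local biholomorphisms at the
relevant point.  Semistability of `G` at a point is expressed by its local normal form:
in suitable centered local holomorphic coordinates on source and target, each of the two
components of `G` is the product of the coordinates in a nonempty finite index set, the
two index sets being disjoint (this covers all the normal forms
`(y_1⋯y_{s_1}, y_{s_1+1}⋯y_{s_2})`, `(y_1⋯y_k, y_{k+1})`, `(y_{k+1}, y_1⋯y_k)`,
`(y_{k+1}, y_{k+2})` of a semistable map to a 2-dimensional base).  Smoothness of the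
fibers `X_t` of `f = p_Δ ∘ G` gives, locally, that `f` is a submersion near `x₀`.
-/

open Filter Topology

noncomputable section

/-- `ψ` is a local biholomorphism at `x`: it is holomorphic at `x` and admits a
holomorphic local inverse. -/
def IsLocalBiholoAt {E F : Type*} [NormedAddCommGroup E] [NormedSpace ℂ E]
    [NormedAddCommGroup F] [NormedSpace ℂ F] (ψ : E → F) (x : E) : Prop :=
  AnalyticAt ℂ ψ x ∧ ∃ χ : F → E, AnalyticAt ℂ χ (ψ x) ∧
    (∀ᶠ y in 𝓝 x, χ (ψ y) = y) ∧ ∀ᶠ z in 𝓝 (ψ x), ψ (χ z) = z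

/-- `G` (written in a fixed chart of `𝒳` and in the coordinates `(t, s)` of `Δ × S`) is
*semistable* at `x₀`: there are centered local holomorphic coordinates `ψ` on the source
and `τ` on the target in which `G` takes the semistable normal form
`y ↦ (∏_{i ∈ A} y_i, ∏_{i ∈ B} y_i)` with `A, B` disjoint nonempty sets of indices. -/
def SemistableAt (n : ℕ) (G : (Fin (n + 1) → ℂ) → ℂ × ℂ) (x₀ : Fin (n + 1) → ℂ) : Prop :=
  ∃ (ψ : (Fin (n + 1) → ℂ) → (Fin (n + 1) → ℂ)) (τ : ℂ × ℂ → ℂ × ℂ)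
    (A B : Finset (Fin (n + 1))),
      IsLocalBiholoAt ψ 0 ∧ ψ 0 = x₀ ∧
      IsLocalBiholoAt τ (G x₀) ∧ τ (G x₀) = 0 ∧
      A.Nonempty ∧ B.Nonempty ∧ Disjoint A B ∧
      ∀ᶠ y in 𝓝 (0 : Fin (n + 1) → ℂ),
        τ (G (ψ y)) = (∏ i ∈ A, y i, ∏ i ∈ B, y i)

section LocalBiholomorphism

variable {E F H : Type*} [NormedAddCommGroup E] [NormedSpace ℂ E]
  [NormedAddCommGroup F] [NormedSpace ℂ F] [NormedAddCommGroup H] [NormedSpace ℂ H]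

theorem IsLocalBiholoAt.comp {g : F → H} {f : E → F} {x : E}
    (hg : IsLocalBiholoAt g (f x)) (hf : IsLocalBiholoAt f x) :
    IsLocalBiholoAt (g ∘ f) x := by
  obtain ⟨hg, g', hg', hgl, hgr⟩ := hg
  obtain ⟨hf, f', hf', hfl, hfr⟩ := hf
  have hg'x : g' (g (f x)) = f x := hgl.self_of_nhds
  have hg't : Tendsto g' (𝓝 (g (f x))) (𝓝 (f x)) := by
    simpa only [hg'x] using hg'.continuousAt.tendsto
  refine ⟨hg.comp hf, f' ∘ g', AnalyticAt.comp (by simpa [hg'x] using hf') hg', ?_, ?_⟩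
  · filter_upwards [hfl, hf.continuousAt.eventually hgl] with y hy hy'
    simp [hy, hy']
  · filter_upwards [hgr, hg't.eventually hfr] with z hz hz'
    simp [hz, hz']

theorem IsLocalBiholoAt.exists_inverse {f : E → F} {x : E} (hf : IsLocalBiholoAt f x) :
    ∃ g : F → E, IsLocalBiholoAt g (f x) ∧ g (f x) = x ∧
      (∀ᶠ y in 𝓝 x, g (f y) = y) ∧ ∀ᶠ z in 𝓝 (f x), f (g z) = z := by
  obtain ⟨hf, g, hg, hl, hr⟩ := hf
  have hx : g (f x) = x := hl.self_of_nhds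
  exact ⟨g, ⟨hg, f, by simpa [hx] using hf, hr, by simpa [hx] using hl⟩, hx, hl, hr⟩

theorem IsLocalBiholoAt.fderiv_injective {f : E → F} {x : E} (hf : IsLocalBiholoAt f x) :
    Function.Injective (fderiv ℂ f x) := by
  obtain ⟨hf, g, hg, hl, -⟩ := hf
  have h : HasFDerivAt (g ∘ f) ((fderiv ℂ g (f x)).comp (fderiv ℂ f x)) x :=
    hg.differentiableAt.hasFDerivAt.comp x hf.differentiableAt.hasFDerivAt
  have h' := h.unique ((hasFDerivAt_id x).congr_of_eventuallyEq hl)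
  exact Function.LeftInverse.injective (g := fderiv ℂ g (f x))
    fun v => by simpa using DFunLike.congr_fun h' v

theorem ContinuousLinearEquiv.isLocalBiholoAt (e : E ≃L[ℂ] F) (x : E) :
    IsLocalBiholoAt e x :=
  ⟨e.analyticAt x, e.symm, e.symm.analyticAt _, by simp, by simp⟩

/-- The holomorphic inverse function theorem. -/
theorem AnalyticAt.isLocalBiholoAt [FiniteDimensional ℂ E] {f : E → E} {x : E}
    (hf : AnalyticAt ℂ f x) (hinj : ∀ v, fderiv ℂ f x v = 0 → v = 0) :
    IsLocalBiholoAt f x := by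
  have : CompleteSpace E := FiniteDimensional.complete ℂ E
  let e : E ≃L[ℂ] E := (LinearEquiv.ofInjectiveEndo (fderiv ℂ f x : E →ₗ[ℂ] E)
    ((injective_iff_map_eq_zero _).2 hinj)).toContinuousLinearEquiv
  have he : fderiv ℂ f x = e := by ext v; rfl
  have hs : HasStrictFDerivAt f (e : E →L[ℂ] E) x := he ▸ hf.hasStrictFDerivAt
  let R := hs.toOpenPartialHomeomorph f
  have hx : x ∈ R.source := hs.mem_toOpenPartialHomeomorph_source
  exact ⟨hf, R.symm, R.analyticAt_symm' hx hf he, R.eventually_left_inverse hx,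
    R.eventually_right_inverse' hx⟩

end LocalBiholomorphism

section HadamardQuotient

variable {E F : Type*} [NormedAddCommGroup E] [NormedSpace ℂ E]
  [NormedAddCommGroup F] [NormedSpace ℂ F] [CompleteSpace F]

/-- Averaging an analytic function over a continuous path of linear contractions yields an
analytic function. -/
theorem AnalyticAt.intervalIntegral_comp {f : E → F} (hf : AnalyticAt ℂ f 0)
    {L : ℝ → E →L[ℂ] E} (hL : Continuous L) (hL1 : ∀ r ∈ Set.Icc (0 : ℝ) 1, ‖L r‖ ≤ 1) :
    AnalyticAt ℂ (fun x => ∫ r in (0 : ℝ)..1, f (L r x)) 0 := by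
  obtain ⟨p, R, hp⟩ := hf
  obtain ⟨ρ, hρ0, hρR⟩ := ENNReal.lt_iff_exists_nnreal_btwn.1 hp.r_pos
  have hsum : Summable fun m => ‖p m‖ * (ρ : ℝ) ^ m :=
    p.summable_norm_mul_pow (hρR.trans_le hp.r_le)
  have hcont : ∀ m, Continuous fun r => (p m).compContinuousLinearMap fun _ => L r :=
    fun m => (ContinuousMultilinearMap.compContinuousLinearMapLRight (p m)).cont.comp
      (continuous_pi fun _ => hL)
  have hIoc : ∀ r ∈ Set.uIoc (0 : ℝ) 1, ‖L r‖ ≤ 1 := fun r hr => by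
    rw [Set.uIoc_of_le zero_le_one] at hr
    exact hL1 r ⟨hr.1.le, hr.2⟩
  refine ⟨fun m => ∫ r in (0 : ℝ)..1, (p m).compContinuousLinearMap fun _ => L r, ρ, ?_, hρ0, ?_⟩
  · refine FormalMultilinearSeries.le_radius_of_summable _
      (hsum.of_nonneg_of_le (fun _ => by positivity) fun m => ?_)
    gcongr
    refine (intervalIntegral.norm_integral_le_of_norm_le_const
      (C := ‖p m‖) fun r hr => ?_).trans_eq (by simp)
    refine (ContinuousMultilinearMap.norm_compContinuousLinearMap_le _ _).trans ?_
    refine mul_le_of_le_one_right (norm_nonneg _) ?_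
    exact Finset.prod_le_one (fun _ _ => norm_nonneg _) fun _ _ => hIoc r hr
  · intro y hy
    have hy' : ‖y‖ < ρ := by simpa using hy
    have hLy : ∀ r ∈ Set.uIoc (0 : ℝ) 1, ‖L r y‖ ≤ ρ := fun r hr =>
      ((L r).le_of_opNorm_le (hIoc r hr) y).trans (by linarith)
    have happ : ∀ m, (∫ r in (0 : ℝ)..1, (p m).compContinuousLinearMap fun _ => L r) (fun _ => y)
        = ∫ r in (0 : ℝ)..1, p m fun _ => L r y := fun m =>
      ((ContinuousMultilinearMap.apply ℂ (fun _ : Fin m => E) F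
        fun _ => y).intervalIntegral_comp_comm ((hcont m).intervalIntegrable 0 1)).symm
    simp only [happ, zero_add]
    refine intervalIntegral.hasSum_integral_of_dominated_convergence
      (fun m _ => ‖p m‖ * (ρ : ℝ) ^ m) (fun m => ?_) (fun m => ?_) ?_ ?_ ?_
    · exact ((p m).cont.comp (continuous_pi fun _ =>
        hL.clm_apply continuous_const)).aestronglyMeasurable
    · refine .of_forall fun r hr => ((p m).le_opNorm _).trans ?_
      simp only [Finset.prod_const, Finset.card_univ, Fintype.card_fin]
      gcongr
      exact hLy r hr
    · exact .of_forall fun _ _ => hsum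
    · exact intervalIntegrable_const
    · refine .of_forall fun r hr => ?_
      simpa using hp.hasSum (y := L r y) (by
        have := (ENNReal.coe_le_coe.2 (show ‖L r y‖₊ ≤ ρ from hLy r hr)).trans_lt hρR
        simpa [enorm] using this)

/-- The Hadamard lemma for holomorphic functions of two variables. -/
theorem AnalyticAt.exists_eq_add_mul {h : ℂ × ℂ → ℂ} (hh : AnalyticAt ℂ h 0) :
    ∃ k : ℂ × ℂ → ℂ, AnalyticAt ℂ k 0 ∧ k 0 = fderiv ℂ h 0 (0, 1) ∧
      ∀ᶠ x in 𝓝 (0 : ℂ × ℂ), h x = h (x.1, 0) + x.2 * k x := by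
  let L : ℝ → ℂ × ℂ →L[ℂ] ℂ × ℂ := fun r =>
    (ContinuousLinearMap.inl ℂ ℂ ℂ).comp (.fst ℂ ℂ ℂ) +
      (r : ℂ) • (ContinuousLinearMap.inr ℂ ℂ ℂ).comp (.snd ℂ ℂ ℂ)
  have hLapp : ∀ r x, L r x = (x.1, (r : ℂ) * x.2) := fun r x => by simp [L]
  have hL : Continuous L := by fun_prop
  have hLle : ∀ r ∈ Set.Icc (0 : ℝ) 1, ∀ x, ‖L r x‖ ≤ ‖x‖ := fun r hr x => by
    rw [hLapp, Prod.norm_def, Prod.norm_def]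
    refine max_le_max le_rfl ?_
    rw [norm_mul, Complex.norm_real, Real.norm_of_nonneg hr.1]
    exact mul_le_of_le_one_left (norm_nonneg _) hr.2
  have hL1 : ∀ r ∈ Set.Icc (0 : ℝ) 1, ‖L r‖ ≤ 1 := fun r hr =>
    (L r).opNorm_le_bound zero_le_one fun x => by simpa using hLle r hr x
  let g : ℂ × ℂ → ℂ := fun x => fderiv ℂ h x (0, 1)
  have hg : AnalyticAt ℂ g 0 := 
    ((ContinuousLinearMap.apply ℂ ℂ ((0 : ℂ), (1 : ℂ))).analyticAt _).comp hh.fderiv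
  refine ⟨fun x => ∫ r in (0 : ℝ)..1, g (L r x), hg.intervalIntegral_comp hL hL1,
    by simp [g], ?_⟩
  obtain ⟨ε, hε, hball⟩ := Metric.eventually_nhds_iff_ball.1
    (hh.eventually_analyticAt.and hg.eventually_analyticAt)
  filter_upwards [Metric.ball_mem_nhds 0 hε] with x hx
  have hmem : ∀ r ∈ Set.uIcc (0 : ℝ) 1, L r x ∈ Metric.ball (0 : ℂ × ℂ) ε := fun r hr => by
    rw [Set.uIcc_of_le zero_le_one] at hr
    rw [mem_ball_zero_iff] at hx ⊢
    exact (hLle r hr x).trans_lt hx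
  have hder : ∀ r ∈ Set.uIcc (0 : ℝ) 1,
      HasDerivAt (fun r => h (L r x)) (x.2 * g (L r x)) r := fun r hr => by
    have hpath : HasDerivAt (fun r : ℝ => L r x) (0, x.2) r := by
      simp only [hLapp]
      exact (hasDerivAt_const r x.1).prodMk
        (by simpa using (hasDerivAt_id r).ofReal_comp.mul_const x.2)
    have hd := (((hball _ (hmem r hr)).1.differentiableAt.hasFDerivAt).restrictScalars
      ℝ).comp_hasDerivAt r hpath
    have hv : ((0 : ℂ), x.2) = x.2 • ((0 : ℂ), (1 : ℂ)) := by simp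
    simpa [hv, g, Function.comp_def, -Prod.smul_mk] using hd
  have hint : IntervalIntegrable (fun r => x.2 * g (L r x)) MeasureTheory.volume 0 1 := by
    refine ContinuousOn.intervalIntegrable fun r hr => ContinuousAt.continuousWithinAt ?_
    refine continuousAt_const.mul ?_
    exact ContinuousAt.comp (f := fun r => L r x) (hball _ (hmem r hr)).2.continuousAt
      (hL.clm_apply continuous_const).continuousAt
  have hftc := intervalIntegral.integral_eq_sub_of_hasDerivAt hder hint
  rw [intervalIntegral.integral_const_mul] at hftc
  rw [hftc]
  simp [hLapp]

end HadamardQuotient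

section NormalForm

/-- If `∂₁ (σ ·).1` does not vanish at the origin, then `(σ w).2` is the sum of a function of
`(σ w).1` and the product of `w.2` with a unit. -/
theorem IsLocalBiholoAt.exists_snd_eq_add_mul {σ : ℂ × ℂ → ℂ × ℂ} (hσ : IsLocalBiholoAt σ 0)
    (hσ0 : σ 0 = 0) (hd : fderiv ℂ (fun w => (σ w).1) 0 (1, 0) ≠ 0) :
    ∃ (l : ℂ → ℂ) (κ : ℂ × ℂ → ℂ), AnalyticAt ℂ l 0 ∧ l 0 = 0 ∧ AnalyticAt ℂ κ 0 ∧ κ 0 ≠ 0 ∧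
      ∀ᶠ w in 𝓝 (0 : ℂ × ℂ), (σ w).2 = l (σ w).1 + w.2 * κ w := by
  let S : ℂ × ℂ → ℂ := fun w => (σ w).1
  let P : ℂ × ℂ → ℂ × ℂ := fun w => (S w, w.2)
  have hS : AnalyticAt ℂ S 0 := (ContinuousLinearMap.fst ℂ ℂ ℂ).analyticAt _ |>.comp hσ.1
  have hPa : AnalyticAt ℂ P 0 := hS.prod analyticAt_snd
  have hP0 : P 0 = 0 := by simp [P, S, hσ0]
  have hP : IsLocalBiholoAt P 0 := by
    refine hPa.isLocalBiholoAt fun v hv => ?_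
    have hPd : HasFDerivAt P ((fderiv ℂ S 0).prod (.snd ℂ ℂ ℂ)) 0 :=
      hS.differentiableAt.hasFDerivAt.prodMk hasFDerivAt_snd
    rw [hPd.fderiv] at hv
    obtain ⟨v₁, v₂⟩ := v
    obtain ⟨h₁, rfl⟩ : fderiv ℂ S 0 (v₁, v₂) = 0 ∧ v₂ = 0 := by simpa using hv
    have hv' : (v₁, (0 : ℂ)) = v₁ • ((1 : ℂ), (0 : ℂ)) := by simp
    rw [hv', map_smul, smul_eq_mul, mul_eq_zero] at h₁
    simpa using h₁.resolve_right hd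
  obtain ⟨Q, hQ, hQ0, hQP, hPQ⟩ := hP.exists_inverse
  rw [hP0] at hQ hQ0 hPQ
  have hH : IsLocalBiholoAt (σ ∘ Q) 0 := IsLocalBiholoAt.comp (by rwa [hQ0]) hQ
  let h : ℂ × ℂ → ℂ := fun x => (σ (Q x)).2
  have hh : AnalyticAt ℂ h 0 := (ContinuousLinearMap.snd ℂ ℂ ℂ).analyticAt _ |>.comp hH.1
  obtain ⟨k, hk, hk0, hhk⟩ := hh.exists_eq_add_mul
  have hk0' : k 0 ≠ 0 := by
    intro hk0'
    have hHd : HasFDerivAt (σ ∘ Q) ((ContinuousLinearMap.fst ℂ ℂ ℂ).prod (fderiv ℂ h 0)) 0 := by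
      refine HasFDerivAt.congr_of_eventuallyEq
        (hasFDerivAt_fst.prodMk hh.differentiableAt.hasFDerivAt) ?_
      filter_upwards [hPQ] with x hx
      exact Prod.ext (show (P (Q x)).1 = x.1 from congrArg Prod.fst hx) rfl
    have hinj := hH.fderiv_injective
    rw [hHd.fderiv] at hinj
    have := @hinj (0, 1) 0 (by simp [← hk0, hk0'])
    simp at this
  have hPt : Tendsto P (𝓝 0) (𝓝 0) := by simpa only [hP0] using hPa.continuousAt.tendsto
  refine ⟨fun t => h (t, 0), fun w => k (P w), ?_, ?_, ?_, by simpa [hP0] using hk0', ?_⟩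
  · exact AnalyticAt.comp (g := h) (f := fun t : ℂ => (t, (0 : ℂ))) hh
      (analyticAt_id.prod analyticAt_const)
  · change (σ (Q 0)).2 = 0
    simp [hQ0, hσ0]
  · exact AnalyticAt.comp (by rwa [hP0]) hPa
  · filter_upwards [hQP, hPt.eventually hhk] with w hw hw'
    simpa only [h, hw, P, S] using hw'

theorem Finset.hasFDerivAt_prod_apply {ι : Type*} [Fintype ι] [DecidableEq ι] (A : Finset ι)
    (x : ι → ℂ) : HasFDerivAt (fun y : ι → ℂ => ∏ i ∈ A, y i)
      (∑ i ∈ A, (∏ j ∈ A.erase i, x j) • (ContinuousLinearMap.proj i : (ι → ℂ) →L[ℂ] ℂ)) x :=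
  HasFDerivAt.finsetProd fun i _ => hasFDerivAt_apply i x

theorem Fin.exists_perm_last_eq_and_lt_card_iff {n : ℕ} {B : Finset (Fin (n + 1))}
    {a : Fin (n + 1)} (ha : a ∉ B) : ∃ e : Equiv.Perm (Fin (n + 1)), e (Fin.last n) = a ∧
      ∀ i : Fin (n + 1), (i : ℕ) < B.card ↔ e i ∈ B := by
  have hB : B.card ≤ n := by
    simpa [Nat.lt_succ_iff] using Finset.card_lt_card (Finset.ssubset_univ_iff.2
      (ne_of_mem_of_not_mem' (Finset.mem_univ a) ha).symm)
  have hcard : Fintype.card {i : Fin (n + 1) // (i : ℕ) < B.card} =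
      Fintype.card {i : Fin (n + 1) // i ∈ B} := by
    rw [Fintype.card_subtype, Fintype.card_coe, Fin.card_filter_val_lt]
    omega
  let e₀ := (Fintype.equivOfCardEq hcard).extendSubtype
  have he₀ : ∀ i : Fin (n + 1), (i : ℕ) < B.card ↔ e₀ i ∈ B := fun i =>
    ⟨fun h => Equiv.extendSubtype_mem (Fintype.equivOfCardEq hcard) i h,
      fun h => by_contra fun h' =>
        Equiv.extendSubtype_not_mem (Fintype.equivOfCardEq hcard) i h' h⟩
  have hlast : e₀ (Fin.last n) ∉ B := by simpa [← he₀] using hB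
  refine ⟨e₀.trans (Equiv.swap (e₀ (Fin.last n)) a), by simp, fun i => ?_⟩
  rw [he₀, Equiv.trans_apply, Equiv.swap_apply_def]
  split_ifs with h₁ h₂
  · simp [h₁, hlast, ha]
  · simp [h₂, hlast, ha]
  · rfl

theorem exists_coordinates_of_biholo {n : ℕ} {g : (Fin (n + 1) → ℂ) → ℂ × ℂ}
    {σ : ℂ × ℂ → ℂ × ℂ} (hσ : IsLocalBiholoAt σ 0) (hσ0 : σ 0 = 0)
    {a : Fin (n + 1)} {B : Finset (Fin (n + 1))} (ha : a ∉ B) (hB : B.Nonempty)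
    (hd : fderiv ℂ (fun w => (σ w).1) 0 (1, 0) ≠ 0)
    (hg : ∀ᶠ y in 𝓝 (0 : Fin (n + 1) → ℂ), g y = σ (y a, ∏ i ∈ B, y i)) :
    ∃ l : ℂ → ℂ, AnalyticAt ℂ l 0 ∧ l 0 = 0 ∧
      ∃ θ : (Fin (n + 1) → ℂ) → (Fin (n + 1) → ℂ), IsLocalBiholoAt θ 0 ∧ θ 0 = 0 ∧
        ∃ p : ℕ, 1 ≤ p ∧ p ≤ n ∧
          ∀ᶠ y in 𝓝 (0 : Fin (n + 1) → ℂ),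
            g (θ y) = (y (Fin.last n),
              (∏ i ∈ Finset.univ.filter (fun i : Fin (n + 1) => (i : ℕ) < p), y i)
                + l (y (Fin.last n))) := by
  obtain ⟨l, κ, hl, hl0, hκ, hκ0, hlκ⟩ := hσ.exists_snd_eq_add_mul hσ0 hd
  obtain ⟨e, hea, heB⟩ := Fin.exists_perm_last_eq_and_lt_card_iff ha
  have hBpos : 0 < B.card := hB.card_pos
  have hBn : B.card ≤ n := by simpa [hea, ha] using heB (Fin.last n)
  let S : ℂ × ℂ → ℂ := fun w => (σ w).1
  have hS : AnalyticAt ℂ S 0 := (ContinuousLinearMap.fst ℂ ℂ ℂ).analyticAt _ |>.comp hσ.1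
  let m : (Fin (n + 1) → ℂ) → ℂ × ℂ := fun y => (y a, ∏ i ∈ B, y i)
  have hm0 : m 0 = 0 := by simp [m, hB.ne_empty]
  have hproj : ∀ i : Fin (n + 1), AnalyticAt ℂ (fun y : Fin (n + 1) → ℂ => y i) 0 := fun i =>
    (ContinuousLinearMap.proj (R := ℂ) (φ := fun _ : Fin (n + 1) => ℂ) i).analyticAt 0
  have hma : AnalyticAt ℂ m 0 :=
    (hproj a).prod (Finset.analyticAt_fun_prod _ fun i _ => hproj i)
  have hSm : AnalyticAt ℂ (fun y => S (m y)) 0 := AnalyticAt.comp (g := S) (by rwa [hm0]) hma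
  have hκm : AnalyticAt ℂ (fun y => κ (m y)) 0 := AnalyticAt.comp (by rwa [hm0]) hma
  let Φ : (Fin (n + 1) → ℂ) → Fin (n + 1) → ℂ := fun y i =>
    if i = Fin.last n then S (m y) else if i = 0 then κ (m y) * y (e i) else y (e i)
  have hΦi : ∀ i, AnalyticAt ℂ (fun y => Φ y i) 0 := fun i => by
    dsimp only [Φ]
    split_ifs
    · exact hSm
    · exact hκm.mul (hproj _)
    · exact hproj _
  have hΦa : AnalyticAt ℂ Φ 0 := AnalyticAt.pi hΦi
  have hΦ0 : Φ 0 = 0 := by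
    ext i
    simp [Φ, S, hm0, hσ0]
  have hΦ : IsLocalBiholoAt Φ 0 := by
    refine hΦa.isLocalBiholoAt fun v hv => ?_
    have hvi : ∀ i, fderiv ℂ (fun y => Φ y i) 0 v = 0 := fun i => by
      have := (hasFDerivAt_pi'.1 hΦa.differentiableAt.hasFDerivAt i).fderiv
      rw [this]
      simp [hv]
    have hve : ∀ i, i ≠ Fin.last n → v (e i) = 0 := fun i hi => by
      have h := hvi i
      have hp := hasFDerivAt_apply (𝕜 := ℂ) (e i) (0 : Fin (n + 1) → ℂ)
      by_cases hi0 : i = 0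
      · simp only [Φ, if_neg hi, if_pos hi0] at h
        rw [(hκm.differentiableAt.hasFDerivAt.fun_mul hp).fderiv] at h
        simpa [hm0, hκ0] using h
      · simp only [Φ, if_neg hi, if_neg hi0] at h
        rwa [hp.fderiv] at h
    have hvB : ∀ b ∈ B, v b = 0 := fun b hb => by
      have hb' : e.symm b ≠ Fin.last n := fun h => ha (by rwa [← hea, ← h, e.apply_symm_apply])
      simpa using hve _ hb'
    have hva : v a = 0 := by
      have h := hvi (Fin.last n)
      have hmd := (hasFDerivAt_apply (𝕜 := ℂ) a (0 : Fin (n + 1) → ℂ)).prodMk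
        (B.hasFDerivAt_prod_apply 0)
      have hSd : HasFDerivAt S (fderiv ℂ S 0) (m 0) := by
        rw [hm0]
        exact hS.differentiableAt.hasFDerivAt
      simp only [Φ, if_true] at h
      rw [show fderiv ℂ (fun y => S (m y)) 0 = _ from (hSd.comp 0 hmd).fderiv] at h
      have hv' : (v a, (0 : ℂ)) = v a • ((1 : ℂ), (0 : ℂ)) := by simp
      have hsum : ∑ b ∈ B, (∏ j ∈ B.erase b, (0 : Fin (n + 1) → ℂ) j) * v b = 0 :=
        Finset.sum_eq_zero fun b hb => by rw [hvB b hb, mul_zero]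
      simp only [ContinuousLinearMap.comp_apply, ContinuousLinearMap.prod_apply,
        ContinuousLinearMap.proj_apply, sum_apply,
        smul_apply, smul_eq_mul, hsum] at h
      rw [hv', map_smul, smul_eq_mul, mul_eq_zero] at h
      exact h.resolve_right hd
    ext j
    by_cases hj : e.symm j = Fin.last n
    · rw [← e.apply_symm_apply j, hj, hea, hva, Pi.zero_apply]
    · simpa using hve _ hj
  obtain ⟨θ, hθ, hθ0, -, hΦθ⟩ := hΦ.exists_inverse
  rw [hΦ0] at hθ hθ0 hΦθ
  have hθt : Tendsto θ (𝓝 0) (𝓝 0) := by simpa only [hθ0] using hθ.1.continuousAt.tendsto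
  have hmt : Tendsto m (𝓝 0) (𝓝 0) := by simpa only [hm0] using hma.continuousAt.tendsto
  refine ⟨l, hl, hl0, θ, hθ, hθ0, B.card, hBpos, hBn, ?_⟩
  filter_upwards [hΦθ, hθt.eventually hg, (hmt.comp hθt).eventually hlκ] with x hx hgx hlx
  have hfst : (σ (m (θ x))).1 = x (Fin.last n) := by
    rw [← congrFun hx (Fin.last n)]
    simp [Φ, S]
  have hprod : ∏ i ∈ Finset.univ.filter (fun i : Fin (n + 1) => (i : ℕ) < B.card), x i =
      (m (θ x)).2 * κ (m (θ x)) := by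
    let I := Finset.univ.filter (fun i : Fin (n + 1) => (i : ℕ) < B.card)
    have h0I : (0 : Fin (n + 1)) ∈ I := by simp [I, hB]
    have hlt : ∀ i ∈ I, i ≠ Fin.last n := by
      rintro i hi rfl
      simp only [I, Finset.mem_filter, Fin.val_last] at hi
      omega
    have hxi : ∀ i ∈ I, x i = (if i = 0 then κ (m (θ x)) else 1) * θ x (e i) := fun i hi => by
      rw [← congrFun hx i]
      simp only [Φ, if_neg (hlt i hi)]
      split_ifs <;> simp
    have hIB : ∏ i ∈ I, θ x (e i) = ∏ i ∈ B, θ x i :=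
      Finset.prod_equiv e (fun i => by simp [I, heB]) fun _ _ => rfl
    rw [show ∏ i ∈ I, x i = _ from Finset.prod_congr rfl hxi, Finset.prod_mul_distrib, hIB,
      Finset.prod_ite_eq' I 0, if_pos h0I, mul_comm]
  rw [hgx]
  change σ (m (θ x)) = _
  refine Prod.ext hfst ?_
  rw [Function.comp_apply, hfst] at hlx
  rw [hlx, hprod, add_comm]

/-- A semistable germ whose first component is a submersion has, after possibly exchanging the
two factors of the target, a single coordinate as the first component of its normal form. -/
theorem SemistableAt.exists_normal_form {n : ℕ} {G : (Fin (n + 1) → ℂ) → ℂ × ℂ}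
    {x₀ : Fin (n + 1) → ℂ} (hss : SemistableAt n G x₀) (hG : AnalyticAt ℂ G x₀)
    (hG0 : G x₀ = 0) (hf : fderiv ℂ (fun x => (G x).1) x₀ ≠ 0) :
    ∃ (ψ : (Fin (n + 1) → ℂ) → (Fin (n + 1) → ℂ)) (σ : ℂ × ℂ → ℂ × ℂ)
      (a : Fin (n + 1)) (B : Finset (Fin (n + 1))),
      IsLocalBiholoAt ψ 0 ∧ ψ 0 = x₀ ∧ IsLocalBiholoAt σ 0 ∧ σ 0 = 0 ∧ a ∉ B ∧ B.Nonempty ∧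
      fderiv ℂ (fun w => (σ w).1) 0 (1, 0) ≠ 0 ∧
      ∀ᶠ y in 𝓝 (0 : Fin (n + 1) → ℂ), G (ψ y) = σ (y a, ∏ i ∈ B, y i) := by
  obtain ⟨ψ, τ, A, B, hψ, hψ0, hτ, hτ0, hA, hB, hAB, hnf⟩ := hss
  obtain ⟨σ, hσ, hσ0, hστ, -⟩ := hτ.exists_inverse
  rw [hτ0] at hσ hσ0
  rw [hG0] at hσ0
  have hψt : Tendsto ψ (𝓝 0) (𝓝 x₀) := by simpa only [hψ0] using hψ.1.continuousAt.tendsto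
  have hGσ : ∀ᶠ y in 𝓝 (0 : Fin (n + 1) → ℂ), G (ψ y) = σ (∏ i ∈ A, y i, ∏ i ∈ B, y i) := by
    filter_upwards [hnf, (hG.continuousAt.tendsto.comp hψt).eventually hστ] with y hy hy'
    rw [← hy]
    exact hy'.symm
  let S : ℂ × ℂ → ℂ := fun w => (σ w).1
  have hS : AnalyticAt ℂ S 0 := (ContinuousLinearMap.fst ℂ ℂ ℂ).analyticAt _ |>.comp hσ.1
  have hprod : ∀ C : Finset (Fin (n + 1)), C.Nonempty → C.card ≠ 1 →
      ∑ i ∈ C, (∏ j ∈ C.erase i, (0 : Fin (n + 1) → ℂ) j) •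
        (ContinuousLinearMap.proj i : (Fin (n + 1) → ℂ) →L[ℂ] ℂ) = 0 := fun C hC hC1 => by
    refine Finset.sum_eq_zero fun i hi => ?_
    have : (C.erase i).card ≠ 0 := by
      have := hC.card_pos
      rw [Finset.card_erase_of_mem hi]
      omega
    rw [Pi.zero_def, Finset.prod_const, zero_pow this]
    exact zero_smul ℂ (ContinuousLinearMap.proj i : (Fin (n + 1) → ℂ) →L[ℂ] ℂ)
  have key : (A.card = 1 ∧ fderiv ℂ S 0 (1, 0) ≠ 0) ∨
      (B.card = 1 ∧ fderiv ℂ S 0 (0, 1) ≠ 0) := by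
    by_contra! hcon
    obtain ⟨hconA, hconB⟩ := hcon
    have hf' : HasFDerivAt (fun x => (G x).1) (fderiv ℂ (fun x => (G x).1) x₀) (ψ 0) := by
      rw [hψ0]
      exact ((ContinuousLinearMap.fst ℂ ℂ ℂ).analyticAt _ |>.comp
        hG).differentiableAt.hasFDerivAt
    have h₁ := hf'.comp 0 hψ.1.differentiableAt.hasFDerivAt
    have hm0 : ((∏ i ∈ A, (0 : Fin (n + 1) → ℂ) i, ∏ i ∈ B, (0 : Fin (n + 1) → ℂ) i) : ℂ × ℂ)
        = 0 := by simp [hA.ne_empty, hB.ne_empty]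
    have hSd : HasFDerivAt S (fderiv ℂ S 0)
        (∏ i ∈ A, (0 : Fin (n + 1) → ℂ) i, ∏ i ∈ B, (0 : Fin (n + 1) → ℂ) i) := by
      rw [hm0]
      exact hS.differentiableAt.hasFDerivAt
    have h₂ := hSd.comp (0 : Fin (n + 1) → ℂ)
      ((A.hasFDerivAt_prod_apply 0).prodMk (B.hasFDerivAt_prod_apply 0))
    have h₃ := h₁.unique (h₂.congr_of_eventuallyEq (hGσ.mono fun y hy => congrArg Prod.fst hy))
    refine hf (ContinuousLinearMap.ext fun u => ?_)
    obtain ⟨v, rfl⟩ := (LinearMap.injective_iff_surjective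
      (f := (fderiv ℂ ψ 0 : (Fin (n + 1) → ℂ) →ₗ[ℂ] _))).1 hψ.fderiv_injective u
    have h₄ := DFunLike.congr_fun h₃ v
    have hsplit : ∀ c d : ℂ, fderiv ℂ S 0 (c, d) =
        c * fderiv ℂ S 0 (1, 0) + d * fderiv ℂ S 0 (0, 1) := fun c d => by
      rw [← smul_eq_mul, ← smul_eq_mul, ← map_smul, ← map_smul, ← map_add]
      simp
    rw [ContinuousLinearMap.comp_apply, ContinuousLinearMap.comp_apply,
      ContinuousLinearMap.prod_apply, hsplit] at h₄
    refine h₄.trans ?_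
    have hzA : ∀ c : ℂ, (A.card ≠ 1 → c = 0) → c * fderiv ℂ S 0 (1, 0) = 0 := fun c hc => by
      by_cases h : A.card = 1
      · rw [hconA h, mul_zero]
      · rw [hc h, zero_mul]
    have hzB : ∀ c : ℂ, (B.card ≠ 1 → c = 0) → c * fderiv ℂ S 0 (0, 1) = 0 := fun c hc => by
      by_cases h : B.card = 1
      · rw [hconB h, mul_zero]
      · rw [hc h, zero_mul]
    rw [hzA _ fun h => by rw [hprod A hA h]; rfl, hzB _ fun h => by rw [hprod B hB h]; rfl]
    simp
  obtain ⟨hA1, hSA⟩ | ⟨hB1, hSB⟩ := key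
  · obtain ⟨a, rfl⟩ := Finset.card_eq_one.1 hA1
    exact ⟨ψ, σ, a, B, hψ, hψ0, hσ, hσ0, Finset.disjoint_singleton_left.1 hAB, hB, hSA,
      by simpa using hGσ⟩
  · obtain ⟨b, rfl⟩ := Finset.card_eq_one.1 hB1
    let ι := ContinuousLinearEquiv.prodComm ℂ ℂ ℂ
    refine ⟨ψ, σ ∘ ι, b, A, hψ, hψ0, IsLocalBiholoAt.comp (by simpa [ι] using hσ)
      (ι.isLocalBiholoAt 0), by simpa [ι] using hσ0, Finset.disjoint_singleton_right.1 hAB, hA,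
      ?_, by simpa [ι] using hGσ⟩
    have hSd : HasFDerivAt S (fderiv ℂ S 0) (ι 0) := by
      rw [map_zero]
      exact hS.differentiableAt.hasFDerivAt
    rw [show fderiv ℂ (fun w => ((σ ∘ ι) w).1) 0 = _ from
      (hSd.comp 0 ι.hasFDerivAt).fderiv]
    simpa [ι] using hSB

end NormalForm

/-- If `G` is semistable at `x₀` (with `G x₀ = (0,0)` in the chosen
coordinates `t, s` of `Δ × S`) and the fibers of `f = p_Δ ∘ G` are smooth (so that `f` is
a submersion near `x₀`), then there exist a holomorphic function `l` — giving the change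
of coordinates `t' = t`, `s' = s − l(t)` on `Δ × S` — and centered local holomorphic
coordinates `ψ` on `𝒳` at `x₀`, and `1 ≤ p ≤ n`, such that locally
`G = (x_{n+1}, x_1 ⋯ x_p + l(x_{n+1}))`, i.e. `t' = x_{n+1}` and `s' = x_1 ⋯ x_p`. -/
theorem local_coordinates (n : ℕ) (G : (Fin (n + 1) → ℂ) → ℂ × ℂ)
    (x₀ : Fin (n + 1) → ℂ) (hG : AnalyticAt ℂ G x₀) (hG0 : G x₀ = 0)
    (hss : SemistableAt n G x₀)
    (hf : ∀ᶠ x in 𝓝 x₀, fderiv ℂ (fun x => (G x).1) x ≠ 0) :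
    ∃ l : ℂ → ℂ, AnalyticAt ℂ l 0 ∧ l 0 = 0 ∧
      ∃ ψ : (Fin (n + 1) → ℂ) → (Fin (n + 1) → ℂ), IsLocalBiholoAt ψ 0 ∧ ψ 0 = x₀ ∧
        ∃ p : ℕ, 1 ≤ p ∧ p ≤ n ∧
          ∀ᶠ y in 𝓝 (0 : Fin (n + 1) → ℂ),
            G (ψ y) = (y (Fin.last n),
              (∏ i ∈ Finset.univ.filter (fun i : Fin (n + 1) => (i : ℕ) < p), y i)
                + l (y (Fin.last n))) := by
  obtain ⟨ψ, σ, a, B, hψ, hψ0, hσ, hσ0, ha, hB, hd, hGσ⟩ :=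
    hss.exists_normal_form hG hG0 hf.self_of_nhds
  obtain ⟨l, hl, hl0, θ, hθ, hθ0, p, hp1, hpn, hGθ⟩ :=
    exists_coordinates_of_biholo (g := G ∘ ψ) hσ hσ0 ha hB hd hGσ
  exact ⟨l, hl, hl0, ψ ∘ θ, IsLocalBiholoAt.comp (by rwa [hθ0]) hθ, by simp [hθ0, hψ0],
    p, hp1, hpn, hGθ⟩
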